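/- arXiv:math/0608191 — 2 statements merged into one kernel-verified Lean document; each statement's English description precedes it below -/
import Mathlib

section
/- Let C be a Hurwitz algebra over a field k of characteristic ≠ 2, S the associated para-Hurwitz algebra and J = H₃(C,*). Then for all a,b ∈ S: [D₀(a), D₀(b)] = 2D_{t_{a,b}}, where D_{t_{a,b}} is the derivation of J which vanishes on e₀, e₁, e₂ and satisfies D_{t_{a,b}}(ι₀(x)) = ι₀(σ_{a,b}(x)), D_{t_{a,b}}(ι₁(x)) = ι₁(½b(a,b)x − (b • x) • a), and D_{t_{a,b}}(ι₂(x)) = ι₂(½b(a,b)x − a • (x • b)) for all x ∈ S, with σ_{a,b}(x) = b(a,x)b − b(b,x)a. -/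
noncomputable section

variable {k : Type*} [Field k] {C : Type*} [NonAssocRing C] [Module k C]
  [SMulCommClass k C C] [IsScalarTower k C C]

/-- The polar form of the norm of the Hurwitz algebra `C`. -/
def bp (q : QuadraticForm k C) (x y : C) : k := QuadraticMap.polar q x y

/-- The standard involution `x ↦ b(x,1)1 - x` of the Hurwitz algebra `C`. -/
def conj (q : QuadraticForm k C) (x : C) : C := bp q x 1 • (1 : C) - x

/-- The para-Hurwitz product `x • y = x̄ ȳ` on `C`. -/
def pmul (q : QuadraticForm k C) (x y : C) : C := conj q x * conj q y

/-- The underlying space of the Jordan algebra `J = H₃(C,*)`, identified with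
`k³ ⊕ S ⊕ S ⊕ S` via the diagonal coordinates and the maps `ι₀, ι₁, ι₂`. -/
abbrev Jtype (k C : Type*) := (Fin 3 → k) × (Fin 3 → C)

/-- The diagonal idempotents `e₀, e₁, e₂` of `J = H₃(C,*)`. -/
def ee (i : Fin 3) : Jtype k C := (Pi.single i 1, 0)

/-- The elements `ι_i(a)` of `J = H₃(C,*)`. -/
def iot (i : Fin 3) (a : C) : Jtype k C := (0, Pi.single i a)

/-- The Jordan product `x ∘ y = ½(xy + yx)` of `J = H₃(C,*)`, written in the
coordinates `J = k³ ⊕ S ⊕ S ⊕ S` (indices mod 3):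
`e_j ∘ e_j = e_j`, `e_j ∘ e_l = 0` for `j ≠ l`, `e_i ∘ ι_i(a) = 0`,
`e_{i+1} ∘ ι_i(a) = e_{i+2} ∘ ι_i(a) = ½ ι_i(a)`,
`ι_i(a) ∘ ι_{i+1}(b) = ι_{i+2}(a • b)`, and
`ι_i(a) ∘ ι_i(b) = 2 b(a,b) (e_{i+1} + e_{i+2})`. -/
def jmul (q : QuadraticForm k C) (x y : Jtype k C) : Jtype k C :=
  (fun j => x.1 j * y.1 j + 2 * bp q (x.2 (j+1)) (y.2 (j+1))
      + 2 * bp q (x.2 (j+2)) (y.2 (j+2)),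
   fun i => ((2:k)⁻¹ * (x.1 (i+1) + x.1 (i+2))) • y.2 i
      + ((2:k)⁻¹ * (y.1 (i+1) + y.1 (i+2))) • x.2 i
      + pmul q (x.2 (i+1)) (y.2 (i+2)) + pmul q (y.2 (i+1)) (x.2 (i+2)))

/-- Derivations of the Jordan algebra `J = H₃(C,*)`. -/
def IsDerivJ (q : QuadraticForm k C) (f : Jtype k C → Jtype k C) : Prop :=
  ∀ x y, f (jmul q x y) = jmul q (f x) y + jmul q x (f y)

/-- The submodule of `Fin 3 → C` of elements supported at the single index `i`. -/
def piComp (k C : Type*) [Field k] [AddCommGroup C] [Module k C] (i : Fin 3) :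
    Submodule k (Fin 3 → C) where
  carrier := {a | ∀ j, j ≠ i → a j = 0}
  add_mem' := by
    intro a b ha hb j hj
    simp [ha j hj, hb j hj]
  zero_mem' := by intro j hj; rfl
  smul_mem' := by
    intro c a ha j hj
    simp [ha j hj]

/-- The `ℤ₂ × ℤ₂`-grading of `J = H₃(C,*)`:
`J_{(0,0)} = k³`, `J_{(1,0)} = ι₀(S)`, `J_{(0,1)} = ι₁(S)`, `J_{(1,1)} = ι₂(S)`. -/
def Jgrade (k C : Type*) [Field k] [AddCommGroup C] [Module k C] :
    ZMod 2 × ZMod 2 → Submodule k (Jtype k C) := fun p =>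
  if p = (0,0) then (⊤ : Submodule k (Fin 3 → k)).prod (⊥ : Submodule k (Fin 3 → C))
  else if p = (1,0) then (⊥ : Submodule k (Fin 3 → k)).prod (piComp k C 0)
  else if p = (0,1) then (⊥ : Submodule k (Fin 3 → k)).prod (piComp k C 1)
  else (⊥ : Submodule k (Fin 3 → k)).prod (piComp k C 2)

end

noncomputable section

variable {k : Type*} [Field k] {C : Type*} [NonAssocRing C] [Module k C]
  [SMulCommClass k C C] [IsScalarTower k C C]

/-- `L_x`, the multiplication operator `y ↦ x ∘ y` on `J`. -/
def Lmul (q : QuadraticForm k C) (x : Jtype k C) : Jtype k C → Jtype k C :=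
  fun y => jmul q x y

/-- The commutator of two maps `J → J`. -/
def brkt (f g : Jtype k C → Jtype k C) : Jtype k C → Jtype k C :=
  fun y => f (g y) - g (f y)

/-- The inner derivation `D_i(a) = 2[L_{ι_i(a)}, L_{e_{i+1}}]` of `J`. -/
def Dfun (q : QuadraticForm k C) (i : Fin 3) (a : C) : Jtype k C → Jtype k C :=
  fun y => (2:k) • brkt (Lmul q (iot i a)) (Lmul q (ee (i+1))) y

/-- The degree of `ι_i(S)` in the `ℤ₂ × ℤ₂`-grading of `J`. -/
def gidx : Fin 3 → ZMod 2 × ZMod 2 := ![(1,0), (0,1), (1,1)]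

end

noncomputable section

variable {k : Type*} [Field k] {C : Type*} [NonAssocRing C] [Module k C]
  [SMulCommClass k C C] [IsScalarTower k C C]

/-- The map `D_{t_{a,b}}` on `J`: it kills `e₀,e₁,e₂` and acts by
`ι₀(x) ↦ ι₀(σ_{a,b}(x))`, `ι₁(x) ↦ ι₁(½b(a,b)x − (b•x)•a)`,
`ι₂(x) ↦ ι₂(½b(a,b)x − a•(x•b))`, where `σ_{a,b}(x) = b(a,x)b − b(b,x)a`. -/
def Dt (q : QuadraticForm k C) (a b : C) : Jtype k C → Jtype k C := fun x =>
  (0, fun i =>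
    if i = 0 then bp q a (x.2 0) • b - bp q b (x.2 0) • a
    else if i = 1 then ((2:k)⁻¹ * bp q a b) • x.2 1 - pmul q (pmul q b (x.2 1)) a
    else ((2:k)⁻¹ * bp q a b) • x.2 2 - pmul q a (pmul q (x.2 2) b))

end
section HurwitzIdentities

variable {k : Type*} [Field k] {C : Type*} [NonAssocRing C] [Module k C]

theorem bp_comm (q : QuadraticForm k C) (x y : C) : bp q x y = bp q y x :=
  QuadraticMap.polar_comm q x y

theorem bp_add_left (q : QuadraticForm k C) (x y z : C) :
    bp q (x + y) z = bp q x z + bp q y z := QuadraticMap.polar_add_left q x y z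

theorem bp_sub_left (q : QuadraticForm k C) (x y z : C) :
    bp q (x - y) z = bp q x z - bp q y z := QuadraticMap.polar_sub_left q x y z

theorem bp_neg_left (q : QuadraticForm k C) (x y : C) : bp q (-x) y = -bp q x y :=
  QuadraticMap.polar_neg_left q x y

theorem bp_smul_left (q : QuadraticForm k C) (c : k) (x y : C) :
    bp q (c • x) y = c * bp q x y := QuadraticMap.polar_smul_left q c x y

theorem bp_add_right (q : QuadraticForm k C) (x y z : C) :
    bp q x (y + z) = bp q x y + bp q x z := QuadraticMap.polar_add_right q x y z

theorem bp_sub_right (q : QuadraticForm k C) (x y z : C) :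
    bp q x (y - z) = bp q x y - bp q x z := QuadraticMap.polar_sub_right q x y z

theorem bp_neg_right (q : QuadraticForm k C) (x y : C) : bp q x (-y) = -bp q x y :=
  QuadraticMap.polar_neg_right q x y

theorem bp_smul_right (q : QuadraticForm k C) (c : k) (x y : C) :
    bp q x (c • y) = c * bp q x y := QuadraticMap.polar_smul_right q c x y

theorem bp_zero_left (q : QuadraticForm k C) (x : C) : bp q 0 x = 0 :=
  QuadraticMap.polar_zero_left q x

theorem bp_zero_right (q : QuadraticForm k C) (x : C) : bp q x 0 = 0 :=
  QuadraticMap.polar_zero_right q x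

theorem eq_of_bp_eq {q : QuadraticForm k C}
    (hreg : ∀ x : C, (∀ y, QuadraticMap.polar q x y = 0) → x = 0) {x y : C}
    (h : ∀ w, bp q x w = bp q y w) : x = y :=
  sub_eq_zero.1 <| hreg _ fun w => by
    simpa only [bp, QuadraticMap.polar_sub_left, sub_eq_zero] using h w

theorem conj_add (q : QuadraticForm k C) (x y : C) : conj q (x + y) = conj q x + conj q y := by
  simp only [conj, bp_add_left]; module

theorem conj_smul (q : QuadraticForm k C) (c : k) (x : C) : conj q (c • x) = c • conj q x := by
  simp only [conj, bp_smul_left]; module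

theorem conj_zero (q : QuadraticForm k C) : conj q 0 = 0 := by
  simp [conj, bp_zero_left]

theorem conj_neg (q : QuadraticForm k C) (x : C) : conj q (-x) = -conj q x := by
  simp only [conj, bp_neg_left]; module

theorem bp_conj_left (q : QuadraticForm k C) (x y : C) :
    bp q (conj q x) y = bp q x (conj q y) := by
  simp only [conj, bp_sub_left, bp_sub_right, bp_smul_left, bp_smul_right, bp_comm q 1 y]
  ring

theorem pmul_add_left (q : QuadraticForm k C) (x y z : C) :
    pmul q (x + y) z = pmul q x z + pmul q y z := by
  simp only [pmul, conj_add, add_mul]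

theorem pmul_add_right (q : QuadraticForm k C) (x y z : C) :
    pmul q x (y + z) = pmul q x y + pmul q x z := by
  simp only [pmul, conj_add, mul_add]

theorem pmul_neg_left (q : QuadraticForm k C) (x y : C) : pmul q (-x) y = -pmul q x y := by
  simp only [pmul, conj_neg, neg_mul]

theorem pmul_neg_right (q : QuadraticForm k C) (x y : C) : pmul q x (-y) = -pmul q x y := by
  simp only [pmul, conj_neg, mul_neg]

theorem pmul_sub_left (q : QuadraticForm k C) (x y z : C) :
    pmul q (x - y) z = pmul q x z - pmul q y z := by
  simp only [sub_eq_add_neg, pmul_add_left, pmul_neg_left]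

theorem pmul_sub_right (q : QuadraticForm k C) (x y z : C) :
    pmul q x (y - z) = pmul q x y - pmul q x z := by
  simp only [sub_eq_add_neg, pmul_add_right, pmul_neg_right]

theorem pmul_zero_left (q : QuadraticForm k C) (x : C) : pmul q 0 x = 0 := by
  simp only [pmul, conj_zero, zero_mul]

theorem pmul_zero_right (q : QuadraticForm k C) (x : C) : pmul q x 0 = 0 := by
  simp only [pmul, conj_zero, mul_zero]

theorem norm_one_eq_one [Nontrivial C] {q : QuadraticForm k C}
    (hcomp : ∀ x y : C, q (x * y) = q x * q y)
    (hreg : ∀ x : C, (∀ y, QuadraticMap.polar q x y = 0) → x = 0) : q 1 = 1 := by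
  by_contra h
  have hz : ∀ x, q x = 0 := fun x => by
    have h1 := hcomp x 1
    rw [mul_one] at h1
    by_contra hx
    exact h (mul_left_cancel₀ hx (by rw [← h1, mul_one]))
  exact one_ne_zero (hreg (1 : C) fun y => by simp [QuadraticMap.polar, hz])

theorem bp_mul_left_self {q : QuadraticForm k C} (hcomp : ∀ x y : C, q (x * y) = q x * q y)
    (x y z : C) : bp q (x * y) (x * z) = q x * bp q y z := by
  simp only [bp, QuadraticMap.polar, ← mul_add, hcomp]; ring

theorem bp_mul_mul {q : QuadraticForm k C} (hcomp : ∀ x y : C, q (x * y) = q x * q y)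
    (x y z w : C) :
    bp q (x * y) (z * w) + bp q (x * w) (z * y) = bp q x z * bp q y w := by
  have h := bp_mul_left_self hcomp (x + z) y w
  simp only [add_mul, bp_add_left, bp_add_right, bp_mul_left_self hcomp] at h
  have hq : q (x + z) = bp q x z + q x + q z := by simp only [bp, QuadraticMap.polar]; ring
  rw [hq, bp_comm q (z * y) (x * w)] at h
  linear_combination h

theorem conj_conj_of_comp {q : QuadraticForm k C} (hcomp : ∀ x y : C, q (x * y) = q x * q y)
    (hreg : ∀ x : C, (∀ y, QuadraticMap.polar q x y = 0) → x = 0) (x : C) :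
    conj q (conj q x) = x := by
  nontriviality C
  have h1 : bp q (1 : C) 1 = 2 := by
    simp only [bp, QuadraticMap.polar_self, norm_one_eq_one hcomp hreg, mul_one,
      nsmul_eq_mul, Nat.cast_ofNat]
  simp only [conj, bp_sub_left, bp_smul_left, h1]
  module

theorem bp_mul_eq_conj_mul [IsScalarTower k C C] {q : QuadraticForm k C} (hcomp : ∀ x y : C, q (x * y) = q x * q y)
    (x y w : C) : bp q (x * y) w = bp q y (conj q x * w) := by
  have h := bp_mul_mul hcomp x y 1 w
  simp only [one_mul] at h
  simp only [conj, sub_mul, smul_mul_assoc, one_mul, bp_sub_right, bp_smul_right,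
    bp_comm q y (x * w)]
  linear_combination h

theorem bp_mul_eq_mul_conj [SMulCommClass k C C] {q : QuadraticForm k C} (hcomp : ∀ x y : C, q (x * y) = q x * q y)
    (x y w : C) : bp q (x * y) w = bp q x (w * conj q y) := by
  have h := bp_mul_mul hcomp x y w 1
  simp only [mul_one] at h
  simp only [conj, mul_sub, mul_smul_comm, mul_one, bp_sub_right, bp_smul_right]
  linear_combination h

variable [SMulCommClass k C C] [IsScalarTower k C C]

theorem conj_mul_rev {q : QuadraticForm k C} (hcomp : ∀ x y : C, q (x * y) = q x * q y)
    (hreg : ∀ x : C, (∀ y, QuadraticMap.polar q x y = 0) → x = 0) (x y : C) :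
    conj q (x * y) = conj q y * conj q x := by
  refine eq_of_bp_eq hreg fun w => ?_
  have hcc := conj_conj_of_comp hcomp hreg
  rw [bp_conj_left, bp_mul_eq_conj_mul hcomp, bp_mul_eq_conj_mul hcomp (conj q y), hcc,
    bp_comm q (conj q x), bp_mul_eq_mul_conj hcomp]

/-- The norm of a para-Hurwitz algebra is associative. -/
theorem bp_pmul_assoc {q : QuadraticForm k C} (hcomp : ∀ x y : C, q (x * y) = q x * q y)
    (hreg : ∀ x : C, (∀ y, QuadraticMap.polar q x y = 0) → x = 0) (x y z : C) :
    bp q (pmul q x y) z = bp q x (pmul q y z) := by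
  have hcc := conj_conj_of_comp hcomp hreg
  rw [pmul, pmul, bp_mul_eq_mul_conj hcomp, hcc, bp_conj_left, conj_mul_rev hcomp hreg]

theorem pmul_pmul_left {q : QuadraticForm k C} (hcomp : ∀ x y : C, q (x * y) = q x * q y)
    (hreg : ∀ x : C, (∀ y, QuadraticMap.polar q x y = 0) → x = 0) (x y z : C) :
    pmul q (pmul q x y) z = bp q x z • y - pmul q (pmul q z y) x := by
  have hcc := conj_conj_of_comp hcomp hreg
  refine eq_of_bp_eq hreg fun w => ?_
  simp only [pmul, conj_mul_rev hcomp hreg, hcc, bp_sub_left, bp_smul_left]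
  rw [bp_mul_eq_mul_conj hcomp (y * x), bp_mul_eq_mul_conj hcomp (y * z), hcc, hcc]
  linear_combination bp_mul_mul hcomp y x w z

theorem pmul_pmul_right {q : QuadraticForm k C} (hcomp : ∀ x y : C, q (x * y) = q x * q y)
    (hreg : ∀ x : C, (∀ y, QuadraticMap.polar q x y = 0) → x = 0) (x y z : C) :
    pmul q x (pmul q y z) = bp q x z • y - pmul q z (pmul q y x) := by
  have hcc := conj_conj_of_comp hcomp hreg
  refine eq_of_bp_eq hreg fun w => ?_
  simp only [pmul, conj_mul_rev hcomp hreg, hcc, bp_sub_left, bp_smul_left]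
  rw [bp_mul_eq_conj_mul hcomp (conj q x), bp_mul_eq_conj_mul hcomp (conj q z), hcc, hcc]
  linear_combination bp_mul_mul hcomp z y x w + bp q y w * bp_comm q z x + bp_comm q (x * y) (z * w)

end HurwitzIdentities

section Albert

variable {k : Type*} [Field k] {C : Type*} [NonAssocRing C] [Module k C]

theorem jmul_comm (q : QuadraticForm k C) (x y : Jtype k C) : jmul q x y = jmul q y x := by
  ext i
  · simp only [jmul, bp_comm q (y.2 _)]; ring
  · simp only [jmul]; module

theorem jmul_sub_left (q : QuadraticForm k C) (x y z : Jtype k C) :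
    jmul q (x - y) z = jmul q x z - jmul q y z := by
  ext i
  · simp only [jmul, Prod.fst_sub, Prod.snd_sub, Pi.sub_apply, bp_sub_left]; ring
  · simp only [jmul, Prod.fst_sub, Prod.snd_sub, Pi.sub_apply, pmul_sub_left,
      pmul_sub_right]
    module

theorem jmul_sub_right (q : QuadraticForm k C) (x y z : Jtype k C) :
    jmul q x (y - z) = jmul q x y - jmul q x z := by
  rw [jmul_comm, jmul_sub_left, jmul_comm q y, jmul_comm q z]

theorem IsDerivJ.brkt {q : QuadraticForm k C} {f g : Jtype k C → Jtype k C}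
    (hf : IsDerivJ q f) (hg : IsDerivJ q g) (hf' : ∀ x y, f (x + y) = f x + f y)
    (hg' : ∀ x y, g (x + y) = g x + g y) : IsDerivJ q (brkt f g) := by
  intro x y
  simp only [_root_.brkt, hf x y, hg x y, hf', hg', hf _ _, hg _ _, jmul_sub_left, jmul_sub_right]
  abel

theorem pmul_smul_left [IsScalarTower k C C] (q : QuadraticForm k C) (c : k) (x y : C) :
    pmul q (c • x) y = c • pmul q x y := by
  simp only [pmul, conj_smul, smul_mul_assoc]

theorem pmul_smul_right [SMulCommClass k C C] (q : QuadraticForm k C) (c : k) (x y : C) :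
    pmul q x (c • y) = c • pmul q x y := by
  simp only [pmul, conj_smul, mul_smul_comm]

theorem Dt_ee (q : QuadraticForm k C) (a b : C) (i : Fin 3) : Dt q a b (ee i) = 0 := by
  ext j
  · rfl
  · fin_cases j <;> simp [Dt, ee, bp_zero_right, pmul_zero_left, pmul_zero_right]

variable [SMulCommClass k C C] [IsScalarTower k C C]

theorem jmul_smul_left (q : QuadraticForm k C) (c : k) (x y : Jtype k C) :
    jmul q (c • x) y = c • jmul q x y := by
  ext i
  · simp only [jmul, Prod.smul_fst, Prod.smul_snd, Pi.smul_apply, bp_smul_left, smul_eq_mul]; ring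
  · simp only [jmul, Prod.smul_fst, Prod.smul_snd, Pi.smul_apply, pmul_smul_left,
      pmul_smul_right, smul_eq_mul]
    module

theorem jmul_smul_right (q : QuadraticForm k C) (c : k) (x y : Jtype k C) :
    jmul q x (c • y) = c • jmul q x y := by
  rw [jmul_comm, jmul_smul_left, jmul_comm]

theorem Dfun_zero_apply (hchar : (2 : k) ≠ 0) (q : QuadraticForm k C) (a : C) (y : Jtype k C) :
    Dfun q 0 a y =
      (![0, -(2 * bp q a (y.2 0)), 2 * bp q a (y.2 0)],
       ![((2:k)⁻¹ * (y.1 1 - y.1 2)) • a, pmul q (y.2 2) a, -pmul q a (y.2 1)]) := by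
  ext i <;> fin_cases i <;>
    simp [Dfun, brkt, Lmul, jmul, iot, ee, bp_zero_left, pmul_zero_left,
      pmul_zero_right, bp_smul_right, pmul_smul_left, pmul_smul_right, bp_add_right]
  · field_simp
    ring
  · exact .inl (mul_inv_cancel_left₀ hchar _)
  · match_scalars
    field_simp
    ring
  · exact smul_inv_smul₀ hchar _
  · exact smul_inv_smul₀ hchar _

theorem Dfun_zero_add (hchar : (2 : k) ≠ 0) (q : QuadraticForm k C) (a : C) (x y : Jtype k C) :
    Dfun q 0 a (x + y) = Dfun q 0 a x + Dfun q 0 a y := by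
  simp only [Dfun_zero_apply hchar]
  ext i <;> fin_cases i <;> simp [bp_add_right, pmul_add_left, pmul_add_right]
  · ring
  · ring
  · module
  · abel

theorem isDerivJ_Dfun_zero (hchar : (2 : k) ≠ 0) {q : QuadraticForm k C}
    (hcomp : ∀ x y : C, q (x * y) = q x * q y)
    (hreg : ∀ x : C, (∀ y, QuadraticMap.polar q x y = 0) → x = 0) (a : C) :
    IsDerivJ q (Dfun q 0 a) := by
  intro x y
  have hA := bp_pmul_assoc hcomp hreg
  have h2 : (2:k) * 2⁻¹ = 1 := mul_inv_cancel₀ hchar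
  simp only [Dfun_zero_apply hchar]
  ext i <;> fin_cases i <;>
    simp [jmul, bp_add_right, bp_smul_right, bp_smul_left, bp_neg_left, bp_neg_right,
      pmul_add_left, pmul_add_right, pmul_smul_left, pmul_smul_right, pmul_neg_left,
      pmul_neg_right]
  · linear_combination -2 * hA (x.2 2) a (y.2 1) + 2 * bp_comm q (pmul q a (x.2 1)) (y.2 2)
      - 2 * hA (y.2 2) a (x.2 1) + 2 * bp_comm q (pmul q (y.2 2) a) (x.2 1)
  · rw [bp_comm q (x.2 0) a]
    linear_combination 2 * hA a (x.2 1) (y.2 2) + 2 * hA a (y.2 1) (x.2 2)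
      + 2 * bp_comm q (x.2 2) (pmul q a (y.2 1))
      - 2 * (x.1 1 * bp q a (y.2 0) + y.1 1 * bp q a (x.2 0)) * h2
  · rw [bp_comm q (x.2 0) a]
    linear_combination 2 * hA (x.2 1) (y.2 2) a + 2 * bp_comm q a (pmul q (x.2 1) (y.2 2))
      - 2 * hA (x.2 2) a (y.2 1) - 2 * bp_comm q (x.2 2) (pmul q a (y.2 1))
      - 2 * hA a (y.2 1) (x.2 2)
      + 2 * (x.1 2 * bp q a (y.2 0) + y.1 2 * bp q a (x.2 0)) * h2
  · rw [pmul_pmul_left hcomp hreg (x.2 2), pmul_pmul_right hcomp hreg (y.2 1),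
      bp_comm q (y.2 1)]
    match_scalars <;> field_simp <;> ring
  · rw [pmul_pmul_left hcomp hreg (x.2 0), pmul_pmul_left hcomp hreg (y.2 0),
      bp_comm q (x.2 0), bp_comm q (y.2 0)]
    match_scalars <;> field_simp <;> ring
  · rw [pmul_pmul_right hcomp hreg a (y.2 2), pmul_pmul_right hcomp hreg a (x.2 2)]
    match_scalars <;> field_simp <;> ring

theorem brkt_Dfun_zero (hchar : (2 : k) ≠ 0) {q : QuadraticForm k C}
    (hcomp : ∀ x y : C, q (x * y) = q x * q y)
    (hreg : ∀ x : C, (∀ y, QuadraticMap.polar q x y = 0) → x = 0) (a b : C) :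
    brkt (Dfun q 0 a) (Dfun q 0 b) = fun y => (2:k) • Dt q a b y := by
  funext y
  simp only [brkt, Dfun_zero_apply hchar]
  ext i <;> fin_cases i <;>
    simp [Dt, bp_smul_right, pmul_neg_left]
  · rw [bp_comm q b a]
    ring
  · rw [bp_comm q b a]
    ring
  · match_scalars <;> field_simp <;> ring
  · rw [pmul_pmul_left hcomp hreg a]
    match_scalars <;> field_simp
    ring
  · rw [pmul_pmul_right hcomp hreg b, bp_comm q b a]
    match_scalars <;> field_simp
    ring

theorem isDerivJ_of_two_smul (hchar : (2 : k) ≠ 0) {q : QuadraticForm k C}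
    {f : Jtype k C → Jtype k C} (h : IsDerivJ q fun y => (2:k) • f y) : IsDerivJ q f := by
  intro x y
  have hxy := h x y
  simp only [jmul_smul_left, jmul_smul_right, ← smul_add] at hxy
  exact smul_right_injective _ hchar hxy

end Albert


/-- `[D₀(a), D₀(b)] = 2 D_{t_{a,b}}`, where `D_{t_{a,b}}` is the
derivation of `J` vanishing on `e₀,e₁,e₂` and acting on the `ι_i(S)` as described. -/
theorem stmt_12 {k : Type*} [Field k] {C : Type*} [NonAssocRing C] [Module k C]
    [SMulCommClass k C C] [IsScalarTower k C C]
    (hchar : (2 : k) ≠ 0)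
    (q : QuadraticForm k C)
    (hcomp : ∀ x y : C, q (x * y) = q x * q y)
    (hreg : ∀ x : C, (∀ y, QuadraticMap.polar q x y = 0) → x = 0) :
    ∀ a b : C,
      brkt (Dfun q 0 a) (Dfun q 0 b) = (fun y => (2:k) • Dt q a b y) ∧
      IsDerivJ q (Dt q a b) ∧
      (∀ i : Fin 3, Dt q a b (ee i) = 0) := by
  intro a b
  have h := brkt_Dfun_zero hchar hcomp hreg a b
  refine ⟨h, isDerivJ_of_two_smul hchar ?_, Dt_ee q a b⟩
  rw [← h]
  exact (isDerivJ_Dfun_zero hchar hcomp hreg a).brkt (isDerivJ_Dfun_zero hchar hcomp hreg b)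
    (Dfun_zero_add hchar q a) (Dfun_zero_add hchar q b)
end

section
/- Let k be a field of characteristic 3 and let J = Sym₃(k), the Jordan algebra of symmetric 3×3 matrices over k with product x ∘ y = ½(xy + yx), J₀ its trace-zero elements, and T_J^o = J₀/k1 as in the context. Then the bilinear form (x̂|ŷ) = t(x ∘ y) and the triple product [x̂ŷẑ] = class of x ∘ (y ∘ z) − y ∘ (x ∘ z) are well defined on T_J^o (they depend only on the classes of x, y, z modulo k1, and x ∘ (y ∘ z) − y ∘ (x ∘ z) ∈ J₀); the form is symmetric and nondegenerate; and with these operations T_J^o is a simple orthogonal triple system. -/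
set_option linter.unusedSectionVars false

noncomputable section

variable (k : Type*) [Field k] [CharP k 3]

/-- The Jordan product `x ∘ y = ½(xy + yx)` on `Mat₃(k)`. -/
def jm (x y : Matrix (Fin 3) (Fin 3) k) : Matrix (Fin 3) (Fin 3) k :=
  (2:k)⁻¹ • (x * y + y * x)

/-- The trace-zero elements `J₀` of `J = Mat₃(k)`. -/
def J0 : Submodule k (Matrix (Fin 3) (Fin 3) k) :=
  LinearMap.ker (Matrix.traceLinearMap (Fin 3) k k)

lemma one_mem_J0 : (1 : Matrix (Fin 3) (Fin 3) k) ∈ J0 k := by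
  have h3 : ((3 : ℕ) : k) = 0 := CharP.cast_eq_zero k 3
  have h3' : (3 : k) = 0 := by exact_mod_cast h3
  simp [J0, Matrix.trace_one, h3']

/-- The line `k1` inside `J₀` (recall `char k = 3`). -/
def K1 : Submodule k (J0 k) :=
  Submodule.span k {(⟨1, one_mem_J0 k⟩ : J0 k)}

/-- The orthogonal triple system `T_J^o = J₀/k1`. -/
abbrev TJo := (J0 k) ⧸ (K1 k)

lemma brkt_mem (x y z : Matrix (Fin 3) (Fin 3) k) :
    jm k x (jm k y z) - jm k y (jm k x z) ∈ J0 k := by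
  have c1 : (y*z*x).trace = (x*y*z).trace := Matrix.trace_mul_cycle y z x
  have c2 : (z*y*x).trace = (x*z*y).trace := Matrix.trace_mul_cycle z y x
  have c3 : (y*x*z).trace = (x*z*y).trace :=
    (Matrix.trace_mul_cycle y x z).trans c2
  have c4 : (z*x*y).trace = (x*y*z).trace :=
    (Matrix.trace_mul_cycle z x y).trans c1
  simp only [J0, LinearMap.mem_ker, Matrix.traceLinearMap_apply, Matrix.trace_sub, jm,
    Matrix.smul_mul, Matrix.mul_smul, mul_add, add_mul, Matrix.trace_smul, Matrix.trace_add,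
    smul_add, smul_eq_mul, ← Matrix.mul_assoc]
  rw [c1, c2, c3, c4]
  ring

end

noncomputable section

variable (k : Type*) [Field k] [CharP k 3]

/-- The symmetric 3×3 matrices over `k`. -/
def Sym3 : Submodule k (Matrix (Fin 3) (Fin 3) k) where
  carrier := {x | x.transpose = x}
  add_mem' := by
    intro a b ha hb
    simp only [Set.mem_setOf_eq, Matrix.transpose_add] at *
    rw [ha, hb]
  zero_mem' := Matrix.transpose_zero
  smul_mem' := by
    intro c x hx
    simp only [Set.mem_setOf_eq, Matrix.transpose_smul] at *
    rw [hx]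

lemma jm_sym (x y : Matrix (Fin 3) (Fin 3) k) (hx : x.transpose = x)
    (hy : y.transpose = y) : (jm k x y).transpose = jm k x y := by
  simp [jm, Matrix.transpose_smul, Matrix.transpose_add, Matrix.transpose_mul, hx, hy,
    add_comm]

/-- The trace-zero symmetric matrices, i.e. the trace-zero part of `J = Sym₃(k)`. -/
def J0S : Submodule k (Matrix (Fin 3) (Fin 3) k) := Sym3 k ⊓ J0 k

lemma one_mem_J0S : (1 : Matrix (Fin 3) (Fin 3) k) ∈ J0S k :=
  ⟨Matrix.transpose_one, one_mem_J0 k⟩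

/-- The line `k1` inside the trace-zero part of `Sym₃(k)` (recall `char k = 3`). -/
def K1S : Submodule k (J0S k) :=
  Submodule.span k {(⟨1, one_mem_J0S k⟩ : J0S k)}

/-- The orthogonal triple system `T_J^o = J₀/k1` for `J = Sym₃(k)`. -/
abbrev TJoS := (J0S k) ⧸ (K1S k)

lemma brkt_mem_S (x y z : J0S k) :
    jm k (x : Matrix (Fin 3) (Fin 3) k) (jm k y z)
      - jm k (y : Matrix (Fin 3) (Fin 3) k) (jm k x z) ∈ J0S k := by
  refine ⟨?_, brkt_mem k x y z⟩
  have hx : (x : Matrix (Fin 3) (Fin 3) k).transpose = x := x.2.1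
  have hy : (y : Matrix (Fin 3) (Fin 3) k).transpose = y := y.2.1
  have hz : (z : Matrix (Fin 3) (Fin 3) k).transpose = z := z.2.1
  show (_ : Matrix (Fin 3) (Fin 3) k).transpose = _
  rw [Matrix.transpose_sub,
    jm_sym k _ _ hx (jm_sym k _ _ hy hz), jm_sym k _ _ hy (jm_sym k _ _ hx hz)]

end

section JordanProduct

variable {k : Type*} [Field k] [CharP k 3]

lemma three_eq_zero_of_charP_three : (3 : k) = 0 := by
  exact_mod_cast CharP.cast_eq_zero k 3

lemma two_ne_zero_of_charP_three : (2 : k) ≠ 0 := by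
  intro h
  have h3 := three_eq_zero_of_charP_three (k := k)
  exact one_ne_zero (α := k) (by linear_combination h3 - h)

lemma inv_two_of_charP_three : (2 : k)⁻¹ = -1 := by
  rw [inv_eq_iff_eq_inv, inv_neg, inv_one]
  linear_combination three_eq_zero_of_charP_three (k := k)

lemma jm_eq_neg (x y : Matrix (Fin 3) (Fin 3) k) : jm k x y = -(x * y + y * x) := by
  rw [jm, inv_two_of_charP_three, neg_one_smul]

lemma jm_commutator (x y z : Matrix (Fin 3) (Fin 3) k) :
    jm k x (jm k y z) - jm k y (jm k x z) = ⁅⁅x, y⁆, z⁆ := by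
  simp only [jm_eq_neg, Ring.lie_def]
  noncomm_ring

lemma trace_jm (x y : Matrix (Fin 3) (Fin 3) k) : (jm k x y).trace = (x * y).trace := by
  rw [jm_eq_neg, Matrix.trace_neg, Matrix.trace_add, Matrix.trace_mul_comm y x]
  linear_combination -(x * y).trace * three_eq_zero_of_charP_three (k := k)

lemma J0S_entries (x : J0S k) :
    x.1 1 0 = x.1 0 1 ∧ x.1 2 0 = x.1 0 2 ∧ x.1 2 1 = x.1 1 2 ∧
      x.1 2 2 = -x.1 0 0 - x.1 1 1 := by
  have hs : x.1.transpose = x.1 := x.2.1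
  have ht : x.1.trace = 0 := x.2.2
  rw [Matrix.trace_fin_three] at ht
  exact ⟨congrFun₂ hs 0 1, congrFun₂ hs 0 2, congrFun₂ hs 1 2, by linear_combination ht⟩

lemma J0S_trace (x : J0S k) : x.1.trace = 0 := x.2.2

lemma mk_eq_mk_iff_add_smul_one {x y : J0S k} :
    (Submodule.Quotient.mk x : TJoS k) = Submodule.Quotient.mk y ↔
      ∃ c : k, x.1 = y.1 + c • (1 : Matrix (Fin 3) (Fin 3) k) := by
  rw [Submodule.Quotient.eq, K1S, Submodule.mem_span_singleton]
  refine exists_congr fun c => ?_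
  rw [Subtype.ext_iff]
  constructor
  · intro h
    have h' : c • (1 : Matrix (Fin 3) (Fin 3) k) = x.1 - y.1 := h
    rw [h']; abel
  · intro h
    change c • (1 : Matrix (Fin 3) (Fin 3) k) = x.1 - y.1
    rw [h]; abel

lemma mk_eq_zero_iff_smul_one {x : J0S k} :
    (Submodule.Quotient.mk x : TJoS k) = 0 ↔
      ∃ c : k, x.1 = c • (1 : Matrix (Fin 3) (Fin 3) k) := by
  rw [← Submodule.Quotient.mk_zero, mk_eq_mk_iff_add_smul_one]
  simp

/-- The double commutator `[[x, y], z]` on trace-zero symmetric matrices. -/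
def doubleCommutator (x y z : J0S k) : J0S k :=
  ⟨⁅⁅x.1, y.1⁆, z.1⁆, jm_commutator x.1 y.1 z.1 ▸ brkt_mem_S k x y z⟩

lemma doubleCommutator_add_smul_one {x x' y y' z z' : J0S k} {a b c : k}
    (hx : x.1 = x'.1 + a • 1) (hy : y.1 = y'.1 + b • 1) (hz : z.1 = z'.1 + c • 1) :
    doubleCommutator x y z = doubleCommutator x' y' z' := by
  apply Subtype.ext
  simp only [doubleCommutator, hx, hy, hz, Ring.lie_def, add_mul, mul_add, smul_mul_assoc,
    mul_smul_comm, one_mul, mul_one, mul_sub, sub_mul, smul_add, smul_sub]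
  module

lemma trace_mul_add_smul_one {x x' y y' : J0S k} {a b : k}
    (hx : x.1 = x'.1 + a • 1) (hy : y.1 = y'.1 + b • 1) :
    (x.1 * y.1).trace = (x'.1 * y'.1).trace := by
  have h3 := three_eq_zero_of_charP_three (k := k)
  simp [hx, hy, add_mul, mul_add, J0S_trace, Matrix.trace_add, Matrix.trace_smul, h3]

/-- A linear section of the projection `J₀ → J₀/k1`. -/
lemma exists_section : ∃ s : TJoS k →ₗ[k] J0S k, ∀ u, Submodule.Quotient.mk (s u) = u := by
  obtain ⟨s, hs⟩ := LinearMap.exists_rightInverse_of_surjective (K1S k).mkQ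
    (Submodule.range_mkQ _)
  exact ⟨s, fun u => LinearMap.congr_fun hs u⟩

variable (k) in
/-- The trace form descends to `J₀/k1`. -/
lemma exists_traceForm : ∃ B : TJoS k →ₗ[k] TJoS k →ₗ[k] k, ∀ x y : J0S k,
    B (Submodule.Quotient.mk x) (Submodule.Quotient.mk y) = (x.1 * y.1).trace := by
  obtain ⟨s, hs⟩ := exists_section (k := k)
  refine ⟨LinearMap.mk₂ k (fun u v => ((s u).1 * (s v).1).trace) ?_ ?_ ?_ ?_, ?_⟩
  · intro u u' v; simp [add_mul]
  · intro c u v; simp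
  · intro u v v'; simp [mul_add]
  · intro c u v; simp
  · intro x y
    obtain ⟨a, ha⟩ := mk_eq_mk_iff_add_smul_one.1 (hs (Submodule.Quotient.mk x))
    obtain ⟨b, hb⟩ := mk_eq_mk_iff_add_smul_one.1 (hs (Submodule.Quotient.mk y))
    exact trace_mul_add_smul_one ha hb

lemma coe_doubleCommutator (x y z : J0S k) : (doubleCommutator x y z).1 =
    (x.1 * y.1 - y.1 * x.1) * z.1 - z.1 * (x.1 * y.1 - y.1 * x.1) := rfl

lemma doubleCommutator_add_left (x y z x' : J0S k) :
    doubleCommutator (x + x') y z = doubleCommutator x y z + doubleCommutator x' y z := by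
  apply Subtype.ext
  simp only [Submodule.coe_add, coe_doubleCommutator, add_mul, mul_add, sub_mul, mul_sub]
  abel

lemma doubleCommutator_smul_left (c : k) (x y z : J0S k) :
    doubleCommutator (c • x) y z = c • doubleCommutator x y z := by
  apply Subtype.ext
  simp only [Submodule.coe_smul, coe_doubleCommutator, sub_mul, mul_sub, smul_mul_assoc,
    mul_smul_comm, smul_sub]

lemma doubleCommutator_add_middle (x y z y' : J0S k) :
    doubleCommutator x (y + y') z = doubleCommutator x y z + doubleCommutator x y' z := by
  apply Subtype.ext
  simp only [Submodule.coe_add, coe_doubleCommutator, add_mul, mul_add, sub_mul, mul_sub]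
  abel

lemma doubleCommutator_smul_middle (c : k) (x y z : J0S k) :
    doubleCommutator x (c • y) z = c • doubleCommutator x y z := by
  apply Subtype.ext
  simp only [Submodule.coe_smul, coe_doubleCommutator, sub_mul, mul_sub, smul_mul_assoc,
    mul_smul_comm, smul_sub]

lemma doubleCommutator_add_right (x y z z' : J0S k) :
    doubleCommutator x y (z + z') = doubleCommutator x y z + doubleCommutator x y z' := by
  apply Subtype.ext
  simp only [Submodule.coe_add, coe_doubleCommutator, add_mul, mul_add, sub_mul, mul_sub]
  abel

lemma doubleCommutator_smul_right (c : k) (x y z : J0S k) :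
    doubleCommutator x y (c • z) = c • doubleCommutator x y z := by
  apply Subtype.ext
  simp only [Submodule.coe_smul, coe_doubleCommutator, sub_mul, mul_sub, smul_mul_assoc,
    mul_smul_comm, smul_sub]

variable (k) in
/-- The double commutator descends to `J₀/k1`. -/
lemma exists_tripleProduct : ∃ P : TJoS k →ₗ[k] TJoS k →ₗ[k] TJoS k →ₗ[k] TJoS k,
    ∀ x y z : J0S k, P (Submodule.Quotient.mk x) (Submodule.Quotient.mk y)
      (Submodule.Quotient.mk z) = Submodule.Quotient.mk (doubleCommutator x y z) := by
  obtain ⟨s, hs⟩ := exists_section (k := k)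
  let D : TJoS k → TJoS k → TJoS k →ₗ[k] TJoS k := fun u v =>
    { toFun := fun w => Submodule.Quotient.mk (doubleCommutator (s u) (s v) (s w))
      map_add' := fun w w' => by
        rw [map_add, doubleCommutator_add_right, Submodule.Quotient.mk_add]
      map_smul' := fun c w => by
        rw [map_smul, doubleCommutator_smul_right, Submodule.Quotient.mk_smul,
          RingHom.id_apply] }
  have hD (u v w) : D u v w = Submodule.Quotient.mk (doubleCommutator (s u) (s v) (s w)) := rfl
  refine ⟨LinearMap.mk₂ k D ?_ ?_ ?_ ?_, ?_⟩
  · refine fun u u' v => LinearMap.ext fun w => ?_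
    rw [LinearMap.add_apply, hD, hD, hD, map_add, doubleCommutator_add_left,
      Submodule.Quotient.mk_add]
  · refine fun c u v => LinearMap.ext fun w => ?_
    rw [LinearMap.smul_apply, hD, hD, map_smul, doubleCommutator_smul_left,
      Submodule.Quotient.mk_smul]
  · refine fun u v v' => LinearMap.ext fun w => ?_
    rw [LinearMap.add_apply, hD, hD, hD, map_add, doubleCommutator_add_middle,
      Submodule.Quotient.mk_add]
  · refine fun c u v => LinearMap.ext fun w => ?_
    rw [LinearMap.smul_apply, hD, hD, map_smul, doubleCommutator_smul_middle,
      Submodule.Quotient.mk_smul]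
  · intro x y z
    obtain ⟨a, ha⟩ := mk_eq_mk_iff_add_smul_one.1 (hs (Submodule.Quotient.mk x))
    obtain ⟨b, hb⟩ := mk_eq_mk_iff_add_smul_one.1 (hs (Submodule.Quotient.mk y))
    obtain ⟨c, hc⟩ := mk_eq_mk_iff_add_smul_one.1 (hs (Submodule.Quotient.mk z))
    rw [LinearMap.mk₂_apply, hD, doubleCommutator_add_smul_one ha hb hc]

/-- The linearised Cayley–Hamilton identity in characteristic 3. -/
lemma exists_doubleCommutator_self_right (x y : J0S k) :
    ∃ c : k, ⁅⁅x.1, y.1⁆, y.1⁆ = ((x.1 * y.1).trace • y.1 - (y.1 * y.1).trace • x.1) +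
      c • (1 : Matrix (Fin 3) (Fin 3) k) := by
  have h3 := three_eq_zero_of_charP_three (k := k)
  obtain ⟨x1, x2, x3, x4⟩ := J0S_entries x
  obtain ⟨y1, y2, y3, y4⟩ := J0S_entries y
  refine ⟨(⁅⁅x.1, y.1⁆, y.1⁆ - ((x.1 * y.1).trace • y.1 - (y.1 * y.1).trace • x.1)) 0 0, ?_⟩
  ext i j
  fin_cases i <;> fin_cases j <;>
    simp [Ring.lie_def, Matrix.mul_apply, Fin.sum_univ_three, Matrix.trace_fin_three,
      x1, x2, x3, x4, y1, y2, y3, y4] <;> grind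

/-- A trace-zero symmetric matrix orthogonal to all of `J₀` is scalar. -/
lemma exists_eq_smul_one_of_forall_trace_mul_eq_zero (x : J0S k)
    (h : ∀ y : J0S k, (x.1 * y.1).trace = 0) :
    ∃ c : k, x.1 = c • (1 : Matrix (Fin 3) (Fin 3) k) := by
  have h2 := two_ne_zero_of_charP_three (k := k)
  have h3 := three_eq_zero_of_charP_three (k := k)
  obtain ⟨x1, x2, x3, x4⟩ := J0S_entries x
  have key (M : Matrix (Fin 3) (Fin 3) k) (hM : M.transpose = M) (hM' : M.trace = 0) :
      (x.1 * M).trace = 0 := h ⟨M, hM, hM'⟩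
  have e1 := key !![0, 1, 0; 1, 0, 0; 0, 0, 0]
    (by ext i j; fin_cases i <;> fin_cases j <;> rfl) (by simp [Matrix.trace_fin_three])
  have e2 := key !![0, 0, 1; 0, 0, 0; 1, 0, 0]
    (by ext i j; fin_cases i <;> fin_cases j <;> rfl) (by simp [Matrix.trace_fin_three])
  have e3 := key !![0, 0, 0; 0, 0, 1; 0, 1, 0]
    (by ext i j; fin_cases i <;> fin_cases j <;> rfl) (by simp [Matrix.trace_fin_three])
  have e4 := key !![1, 0, 0; 0, -1, 0; 0, 0, 0]
    (by ext i j; fin_cases i <;> fin_cases j <;> rfl) (by simp [Matrix.trace_fin_three])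
  simp [Matrix.trace_fin_three, Matrix.mul_apply, Fin.sum_univ_three, x1, x2, x3]
    at e1 e2 e3 e4
  refine ⟨x.1 0 0, ?_⟩
  ext i j
  fin_cases i <;> fin_cases j <;> simp [x1, x2, x3, x4] <;> grind

/-- The trace-zero symmetric matrices `E₀₁ + E₁₀` and `E₀₂ + E₂₀` are orthogonal and
anisotropic. -/
lemma exists_orthogonal_anisotropic : ∃ x y : J0S k,
    (x.1 * y.1).trace = 0 ∧ (x.1 * x.1).trace ≠ 0 ∧ (y.1 * y.1).trace ≠ 0 := by
  have h2 := two_ne_zero_of_charP_three (k := k)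
  refine ⟨⟨!![0, 1, 0; 1, 0, 0; 0, 0, 0],
      by ext i j; fin_cases i <;> fin_cases j <;> rfl,
      by simp [J0, Matrix.trace_fin_three]⟩,
    ⟨!![0, 0, 1; 0, 0, 0; 1, 0, 0],
      by ext i j; fin_cases i <;> fin_cases j <;> rfl,
      by simp [J0, Matrix.trace_fin_three]⟩, ?_, ?_, ?_⟩ <;>
    simp [Matrix.trace_fin_three, one_add_one_eq_two, h2]

end JordanProduct

/-- Simplicity follows from nondegeneracy and `[xyy] = (x|y)y − (y|y)x`. -/
lemma eq_bot_or_eq_top_of_orthogonal_triple {k T : Type*} [Field k] [AddCommGroup T] [Module k T]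
    (B : T →ₗ[k] T →ₗ[k] k) (P : T →ₗ[k] T →ₗ[k] T →ₗ[k] T)
    (hB : ∀ u, (∀ v, B u v = 0) → u = 0)
    (hP : ∀ u w, P u w w = B u w • w - B w w • u)
    (I : Submodule k T) (hI : ∀ x ∈ I, ∀ y z, P x y z ∈ I) : I = ⊥ ∨ I = ⊤ := by
  refine or_iff_not_imp_left.2 fun hbot => ?_
  obtain ⟨x, hx, hx0⟩ := I.ne_bot_iff.1 hbot
  have mem (w : T) (hw : B x w ≠ 0) : w ∈ I := by
    have h := I.add_mem (hI x hx w w) (I.smul_mem (B w w) hx)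
    rw [hP, sub_add_cancel] at h
    exact (I.smul_mem_iff hw).1 h
  obtain ⟨v, hv⟩ : ∃ v, B x v ≠ 0 := by
    by_contra! h
    exact hx0 (hB x h)
  refine I.eq_top_iff'.2 fun w => ?_
  by_cases hw : B x w = 0
  · have h := mem (w + v) (by rwa [map_add, hw, zero_add])
    exact (I.add_mem_iff_left (mem v hv)).1 h
  · exact mem w hw

/-- For `J = Sym₃(k)` (symmetric 3×3 matrices with the Jordan product)
over a field `k` of characteristic 3, the trace form and the triple product
`[x̂ŷẑ] = class of [L_x,L_y](z)` are well defined on `T_J^o = J₀/k1`, the form is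
symmetric and nondegenerate, and `T_J^o` is a simple orthogonal triple system. -/
theorem stmt_17 (k : Type*) [Field k] [CharP k 3] :
    ∃ (B : TJoS k →ₗ[k] TJoS k →ₗ[k] k)
      (P : TJoS k →ₗ[k] TJoS k →ₗ[k] TJoS k →ₗ[k] TJoS k),
      -- B is induced by the trace form:
      (∀ x y : J0S k,
        B (Submodule.Quotient.mk x) (Submodule.Quotient.mk y)
          = Matrix.trace (jm k (x : Matrix (Fin 3) (Fin 3) k) (y : Matrix (Fin 3) (Fin 3) k))) ∧
      -- P is induced by (x,y,z) ↦ x∘(y∘z) − y∘(x∘z), which is symmetric of trace zero: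
      (∀ x y z : J0S k,
        P (Submodule.Quotient.mk x) (Submodule.Quotient.mk y) (Submodule.Quotient.mk z)
          = Submodule.Quotient.mk
              (⟨jm k (x : Matrix (Fin 3) (Fin 3) k) (jm k y z)
                  - jm k (y : Matrix (Fin 3) (Fin 3) k) (jm k x z),
                brkt_mem_S k x y z⟩ : J0S k)) ∧
      -- the form is symmetric and nondegenerate:
      (∀ u v, B u v = B v u) ∧
      (∀ u, (∀ v, B u v = 0) → u = 0) ∧
      -- (T_J^o, B, P) is an orthogonal triple system:
      B ≠ 0 ∧
      (∀ u w, P u u w = 0) ∧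
      (∀ u w, P u w w = B u w • w - B w w • u) ∧
      (∀ a b u v w, P a b (P u v w)
        = P (P a b u) v w + P u (P a b v) w + P u v (P a b w)) ∧
      (∀ a b u v, B (P a b u) v + B u (P a b v) = 0) ∧
      -- which is simple:
      (∃ u v w, P u v w ≠ 0) ∧
      (∀ I : Submodule k (TJoS k),
        (∀ x ∈ I, ∀ y z : TJoS k, P x y z ∈ I ∧ P y x z ∈ I ∧ P y z x ∈ I) →
        I = ⊥ ∨ I = ⊤) := by
  obtain ⟨B, hB⟩ := exists_traceForm k
  obtain ⟨P, hP⟩ := exists_tripleProduct k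
  have hnd : ∀ u, (∀ v, B u v = 0) → u = 0 := by
    intro u hu
    obtain ⟨x, rfl⟩ := Submodule.Quotient.mk_surjective _ u
    rw [mk_eq_zero_iff_smul_one]
    refine exists_eq_smul_one_of_forall_trace_mul_eq_zero x fun y => ?_
    rw [← hB, hu]
  have hPself : ∀ u w, P u w w = B u w • w - B w w • u := by
    intro u w
    obtain ⟨x, rfl⟩ := Submodule.Quotient.mk_surjective _ u
    obtain ⟨y, rfl⟩ := Submodule.Quotient.mk_surjective _ w
    rw [hP, hB, hB, ← Submodule.Quotient.mk_smul, ← Submodule.Quotient.mk_smul,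
      ← Submodule.Quotient.mk_sub, mk_eq_mk_iff_add_smul_one]
    exact exists_doubleCommutator_self_right x y
  obtain ⟨p, q, hpq, hpp, hqq⟩ := exists_orthogonal_anisotropic (k := k)
  refine ⟨B, P, ?_, ?_, ?_, hnd, ?_, ?_, hPself, ?_, ?_, ?_, ?_⟩
  · intro x y
    rw [hB, trace_jm]
  · intro x y z
    rw [hP]
    congr 1
    exact Subtype.ext (jm_commutator x.1 y.1 z.1).symm
  · intro u v
    obtain ⟨x, rfl⟩ := Submodule.Quotient.mk_surjective _ u
    obtain ⟨y, rfl⟩ := Submodule.Quotient.mk_surjective _ v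
    rw [hB, hB, Matrix.trace_mul_comm]
  · rintro rfl
    exact hpp (hB p p).symm
  · intro u w
    obtain ⟨x, rfl⟩ := Submodule.Quotient.mk_surjective _ u
    obtain ⟨y, rfl⟩ := Submodule.Quotient.mk_surjective _ w
    rw [hP, mk_eq_zero_iff_smul_one]
    exact ⟨0, by simp [doubleCommutator, Ring.lie_def]⟩
  · intro a b u v w
    obtain ⟨a, rfl⟩ := Submodule.Quotient.mk_surjective _ a
    obtain ⟨b, rfl⟩ := Submodule.Quotient.mk_surjective _ b
    obtain ⟨u, rfl⟩ := Submodule.Quotient.mk_surjective _ u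
    obtain ⟨v, rfl⟩ := Submodule.Quotient.mk_surjective _ v
    obtain ⟨w, rfl⟩ := Submodule.Quotient.mk_surjective _ w
    simp only [hP, ← Submodule.Quotient.mk_add]
    congr 1
    apply Subtype.ext
    change ⁅⁅a.1, b.1⁆, ⁅⁅u.1, v.1⁆, w.1⁆⁆ = ⁅⁅⁅⁅a.1, b.1⁆, u.1⁆, v.1⁆, w.1⁆ +
      ⁅⁅u.1, ⁅⁅a.1, b.1⁆, v.1⁆⁆, w.1⁆ + ⁅⁅u.1, v.1⁆, ⁅⁅a.1, b.1⁆, w.1⁆⁆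
    generalize ⁅a.1, b.1⁆ = c
    simp only [Ring.lie_def]
    noncomm_ring
  · intro a b u v
    obtain ⟨a, rfl⟩ := Submodule.Quotient.mk_surjective _ a
    obtain ⟨b, rfl⟩ := Submodule.Quotient.mk_surjective _ b
    obtain ⟨u, rfl⟩ := Submodule.Quotient.mk_surjective _ u
    obtain ⟨v, rfl⟩ := Submodule.Quotient.mk_surjective _ v
    rw [hP, hP, hB, hB]
    change (⁅⁅a.1, b.1⁆, u.1⁆ * v.1).trace + (u.1 * ⁅⁅a.1, b.1⁆, v.1⁆).trace = 0
    generalize ⁅a.1, b.1⁆ = c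
    rw [Ring.lie_def, Ring.lie_def, sub_mul, mul_sub, Matrix.trace_sub, Matrix.trace_sub,
      mul_assoc, mul_assoc, Matrix.trace_mul_comm c, mul_assoc]
    abel
  · refine ⟨Submodule.Quotient.mk p, Submodule.Quotient.mk q, Submodule.Quotient.mk q, ?_⟩
    rw [hPself, hB, hB, hpq, zero_smul, zero_sub, neg_ne_zero]
    refine smul_ne_zero hqq fun h => hpp ?_
    rw [← hB, h, map_zero]
  · intro I hI
    exact eq_bot_or_eq_top_of_orthogonal_triple B P hnd hPself I fun x hx y z => (hI x hx y z).1
end
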